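/- arXiv:1612.04120 — 3 statements merged into one kernel-verified Lean document; each statement's English description precedes it below -/
import Mathlib

section
/- Under the Weierstrass decomposition hypothesis, if Y_* ∈ ℂ^m satisfies (F − G) Y_* = 0 and Y_* = Q_p c for some c ∈ ℂ^p, then J c = c; consequently Q_p · J^k · (Q_p^*Q_p)^{-1} Q_p^* · Y_* = Y_* for every k ≥ 0. -/
open Matrix Filter Topology

noncomputable section

/-- Euclidean (ℓ²) norm on ℂ-vectors indexed by a finite type. -/
def euclNorm {n : Type*} [Fintype n] (v : n → ℂ) : ℝ :=
  ‖(WithLp.equiv 2 (n → ℂ)).symm v‖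

/-- Operator norm of a matrix, induced by the Euclidean norms. -/
def matOpNorm {α β : Type*} [Fintype α] [Fintype β] [DecidableEq β]
    (A : Matrix α β ℂ) : ℝ :=
  ‖LinearMap.toContinuousLinearMap (Matrix.toEuclideanLin A)‖
/-- If `Y_*` is an equilibrium state written as `Y_* = Q_p c`, then `J c = c`
and the optimal solution starting from `Y_*` is constantly `Y_*`. -/
theorem equilibrium_fixed_by_optimal (p q : ℕ) (hp : 1 ≤ p)
    (F G P Q : Matrix (Fin p ⊕ Fin q) (Fin p ⊕ Fin q) ℂ)
    (J : Matrix (Fin p) (Fin p) ℂ) (H : Matrix (Fin q) (Fin q) ℂ)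
    (hP : IsUnit P) (hQ : IsUnit Q) (hH : IsNilpotent H)
    (hF : P * F * Q = Matrix.fromBlocks 1 0 0 H)
    (hG : P * G * Q = Matrix.fromBlocks J 0 0 1)
    (Qp : Matrix (Fin p ⊕ Fin q) (Fin p) ℂ)
    (hQp : Qp = Q.submatrix id Sum.inl)
    (Ystar : (Fin p ⊕ Fin q) → ℂ) (hFG : (F - G).mulVec Ystar = 0)
    (c : Fin p → ℂ) (hc : Ystar = Qp.mulVec c) :
    J.mulVec c = c ∧
      ∀ k : ℕ,
        Qp.mulVec ((J ^ k).mulVec (((Qpᴴ * Qp)⁻¹ * Qpᴴ).mulVec Ystar)) = Ystar := by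
  have hQc : Ystar = Q.mulVec (Sum.elim c 0) := by
    rw [hc, hQp]
    ext i
    simp [Matrix.mulVec, dotProduct, Fintype.sum_sum_type]
  have hJ : J.mulVec c = c := by
    have h1 : (P * F * Q - P * G * Q).mulVec (Sum.elim c 0) = 0 := by
      rw [← sub_mul, ← mul_sub, ← Matrix.mulVec_mulVec, ← hQc, ← Matrix.mulVec_mulVec, hFG,
        Matrix.mulVec_zero]
    rw [hF, hG, Matrix.sub_mulVec, Matrix.fromBlocks_mulVec, Matrix.fromBlocks_mulVec] at h1
    ext i
    have h2 := congrFun h1 (Sum.inl i)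
    simp [Function.comp_def] at h2
    exact (sub_eq_zero.mp h2).symm
  refine ⟨hJ, fun k => ?_⟩
  have hinj : Function.Injective Qp.mulVec := by
    intro a b hab
    have hh : ∀ a : Fin p → ℂ, Qp.mulVec a = Q.mulVec (Sum.elim a 0) := by
      intro a
      rw [hQp]
      ext i
      simp [Matrix.mulVec, dotProduct, Fintype.sum_sum_type]
    rw [hh, hh] at hab
    have h3 := Matrix.mulVec_injective_of_isUnit hQ hab
    ext i
    exact congrFun h3 (Sum.inl i)
  have hu : IsUnit (Qpᴴ * Qp) := by
    open scoped ComplexOrder in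
    exact (Matrix.PosDef.conjTranspose_mul_self Qp hinj).isUnit
  have hk : (J ^ k).mulVec c = c := by
    induction k with
    | zero => simp
    | succ n ih => rw [pow_succ, ← Matrix.mulVec_mulVec, hJ, ih]
  have hl : ((Qpᴴ * Qp)⁻¹ * Qpᴴ).mulVec Ystar = c := by
    rw [hc, Matrix.mulVec_mulVec, Matrix.mul_assoc,
      Matrix.nonsing_inv_mul _ ((Matrix.isUnit_iff_isUnit_det _).mp hu), Matrix.one_mulVec]
  rw [hl, hk, hc]
end
end

section
/- Under the Weierstrass decomposition hypothesis, let Y_* be an equilibrium state (i.e. (F − G)Y_* = 0 and Y_* ∈ colspan Q_p), let Y_0 ∈ ℂ^m, and let Ŷ_k = Q_p J^k (Q_p^*Q_p)^{-1} Q_p^* Y_0 be the optimal solution. Then for every k ≥ 0, ‖Ŷ_k − Y_*‖ ≤ ‖Q_p‖ · ‖J^k‖ · ‖(Q_p^*Q_p)^{-1} Q_p^*‖ · ‖Y_0 − Y_*‖, where ‖·‖ denotes the Euclidean norm on vectors and the corresponding operator norm on matrices. -/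
open Matrix Filter Topology

noncomputable section

theorem euclNorm_mulVec_le {α β : Type*} [Fintype α] [Fintype β] [DecidableEq β]
    (A : Matrix α β ℂ) (v : β → ℂ) : euclNorm (A.mulVec v) ≤ matOpNorm A * euclNorm v := by
  exact (LinearMap.toContinuousLinearMap (Matrix.toEuclideanLin A)).le_opNorm
    ((WithLp.equiv 2 (β → ℂ)).symm v)

theorem matOpNorm_nonneg {α β : Type*} [Fintype α] [Fintype β] [DecidableEq β]
    (A : Matrix α β ℂ) : 0 ≤ matOpNorm A := norm_nonneg _

/-- Key estimate of Theorem 3.1: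
`‖Ŷ_k - Y_*‖ ≤ ‖Q_p‖ ‖J^k‖ ‖(Q_p^*Q_p)⁻¹Q_p^*‖ ‖Y₀ - Y_*‖`. -/
theorem optimal_solution_estimate (p q : ℕ) (hp : 1 ≤ p)
    (F G P Q : Matrix (Fin p ⊕ Fin q) (Fin p ⊕ Fin q) ℂ)
    (J : Matrix (Fin p) (Fin p) ℂ) (H : Matrix (Fin q) (Fin q) ℂ)
    (hP : IsUnit P) (hQ : IsUnit Q) (hH : IsNilpotent H)
    (hF : P * F * Q = Matrix.fromBlocks 1 0 0 H)
    (hG : P * G * Q = Matrix.fromBlocks J 0 0 1)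
    (Qp : Matrix (Fin p ⊕ Fin q) (Fin p) ℂ)
    (hQp : Qp = Q.submatrix id Sum.inl)
    (Ystar : (Fin p ⊕ Fin q) → ℂ) (hFG : (F - G).mulVec Ystar = 0)
    (hmem : Ystar ∈ Submodule.span ℂ (Set.range Qpᵀ))
    (Y0 : (Fin p ⊕ Fin q) → ℂ) :
    ∀ k : ℕ,
      euclNorm (Qp.mulVec ((J ^ k).mulVec (((Qpᴴ * Qp)⁻¹ * Qpᴴ).mulVec Y0)) - Ystar) ≤
        matOpNorm Qp * matOpNorm (J ^ k) * matOpNorm ((Qpᴴ * Qp)⁻¹ * Qpᴴ) *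
          euclNorm (Y0 - Ystar) := by
  intro k
  have hQpv : ∀ w : Fin p → ℂ, Qp.mulVec w = Q.mulVec (Sum.elim w 0) := by
    intro w
    ext i
    simp [hQp, Matrix.mulVec, dotProduct, Fintype.sum_sum_type]
  have hQinj : Function.Injective Q.mulVec := Matrix.mulVec_injective_iff_isUnit.mpr hQ
  have hinj : Function.Injective Qp.mulVec := by
    intro a b hab
    simp only [hQpv] at hab
    have h := hQinj hab
    funext i
    exact congrFun h (Sum.inl i)
  have hunit : IsUnit (Qpᴴ * Qp) := by
    open scoped ComplexOrder in
    exact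
      (Matrix.PosDef.conjTranspose_mul_self Qp hinj).isUnit
  have hinv : (Qpᴴ * Qp)⁻¹ * (Qpᴴ * Qp) = 1 :=
    Matrix.nonsing_inv_mul _ ((Matrix.isUnit_iff_isUnit_det _).mp hunit)
  obtain ⟨c, hc⟩ : ∃ c, Qp.mulVec c = Ystar := by
    have : Ystar ∈ LinearMap.range Qp.mulVecLin := by
      rw [Matrix.range_mulVecLin]; exact hmem
    obtain ⟨c, hc⟩ := this
    exact ⟨c, hc⟩
  have hJ : J.mulVec c = c := by
    have h1 : (P * F * Q).mulVec (Sum.elim c 0) = (P * G * Q).mulVec (Sum.elim c 0) := by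
      rw [Matrix.sub_mulVec, sub_eq_zero] at hFG
      simp only [← Matrix.mulVec_mulVec, ← hQpv, hc, hFG]
    rw [hF, hG, Matrix.fromBlocks_mulVec, Matrix.fromBlocks_mulVec] at h1
    funext i
    have h2 := congrFun h1 (Sum.inl i)
    simpa using h2.symm
  have hJk : (J ^ k).mulVec c = c := by
    induction k with
    | zero => simp
    | succ n ih => rw [pow_succ, ← Matrix.mulVec_mulVec, hJ, ih]
  have hM : ((Qpᴴ * Qp)⁻¹ * Qpᴴ).mulVec Ystar = c := by
    rw [← hc, Matrix.mulVec_mulVec, Matrix.mul_assoc, hinv, Matrix.one_mulVec]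
  have key : Qp.mulVec ((J ^ k).mulVec (((Qpᴴ * Qp)⁻¹ * Qpᴴ).mulVec Y0)) - Ystar =
      Qp.mulVec ((J ^ k).mulVec (((Qpᴴ * Qp)⁻¹ * Qpᴴ).mulVec (Y0 - Ystar))) := by
    rw [Matrix.mulVec_sub _ Y0, hM, Matrix.mulVec_sub, hJk, Matrix.mulVec_sub, hc]
  rw [key, mul_assoc, mul_assoc]
  refine (euclNorm_mulVec_le _ _).trans
    (mul_le_mul_of_nonneg_left ?_ (matOpNorm_nonneg _))
  refine (euclNorm_mulVec_le _ _).trans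
    (mul_le_mul_of_nonneg_left ?_ (matOpNorm_nonneg _))
  exact euclNorm_mulVec_le _ _
end
end

section
/- Under the Weierstrass decomposition hypothesis, suppose that for the equilibrium state Y_* = 0 the optimal solutions are Lyapunov stable, i.e. for every ε > 0 there exists δ > 0 such that ‖Y_0‖ ≤ δ implies ‖Q_p J^k (Q_p^*Q_p)^{-1} Q_p^* Y_0‖ ≤ ε for all k ≥ 0. Then there exists a constant c ∈ (0, ∞) such that ‖J^k‖ ≤ c for all k ≥ 0 (operator norm). -/
open Matrix Filter Topology

noncomputable section

theorem euclNorm_smul {n : Type*} [Fintype n] (a : ℂ) (v : n → ℂ) :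
    euclNorm (a • v) = ‖a‖ * euclNorm v := by
  exact norm_smul a ((WithLp.equiv 2 (n → ℂ)).symm v)

theorem matOpNorm_le {α β : Type*} [Fintype α] [Fintype β] [DecidableEq β]
    (A : Matrix α β ℂ) (c : ℝ) (hc : 0 ≤ c)
    (h : ∀ v, euclNorm (A.mulVec v) ≤ c * euclNorm v) : matOpNorm A ≤ c := by
  refine ContinuousLinearMap.opNorm_le_bound _ hc fun x => ?_
  exact h ((WithLp.equiv 2 (β → ℂ)) x)

theorem euclNorm_nonneg {n : Type*} [Fintype n] (v : n → ℂ) : 0 ≤ euclNorm v :=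
  norm_nonneg _

theorem euclNorm_eq_zero {n : Type*} [Fintype n] {v : n → ℂ} (h : euclNorm v = 0) : v = 0 := by
  have := norm_eq_zero.mp h
  simpa using this

open scoped ComplexOrder in
theorem isUnit_gram {α β : Type*} [Fintype α] [Fintype β] [DecidableEq β]
    (A : Matrix α β ℂ) (h : Function.Injective A.mulVec) : IsUnit (Aᴴ * A) :=
  (Matrix.PosDef.conjTranspose_mul_self A h).isUnit

/-- Theorem 3.1 (necessity): if the optimal solutions are Lyapunov stable at the
equilibrium `Y_* = 0`, then `‖J^k‖` is uniformly bounded. -/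
theorem bounded_powers_of_lyapunov_stable (p q : ℕ) (hp : 1 ≤ p)
    (F G P Q : Matrix (Fin p ⊕ Fin q) (Fin p ⊕ Fin q) ℂ)
    (J : Matrix (Fin p) (Fin p) ℂ) (H : Matrix (Fin q) (Fin q) ℂ)
    (hP : IsUnit P) (hQ : IsUnit Q) (hH : IsNilpotent H)
    (hF : P * F * Q = Matrix.fromBlocks 1 0 0 H)
    (hG : P * G * Q = Matrix.fromBlocks J 0 0 1)
    (Qp : Matrix (Fin p ⊕ Fin q) (Fin p) ℂ)
    (hQp : Qp = Q.submatrix id Sum.inl)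
    (hstab : ∀ ε > (0 : ℝ), ∃ δ > (0 : ℝ), ∀ Y0 : (Fin p ⊕ Fin q) → ℂ,
      euclNorm Y0 ≤ δ →
        ∀ k : ℕ,
          euclNorm (Qp.mulVec ((J ^ k).mulVec (((Qpᴴ * Qp)⁻¹ * Qpᴴ).mulVec Y0))) ≤ ε) :
    ∃ c : ℝ, 0 < c ∧ ∀ k : ℕ, matOpNorm (J ^ k) ≤ c := by
  obtain ⟨δ, hδ, hs⟩ := hstab 1 one_pos
  set L : Matrix (Fin p) (Fin p ⊕ Fin q) ℂ := (Q⁻¹).submatrix Sum.inl id with hL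
  have hdet : IsUnit Q.det := (Matrix.isUnit_iff_isUnit_det Q).mp hQ
  have hLQ : L * Qp = 1 := by
    have h1 : Q⁻¹ * Q = 1 := Matrix.nonsing_inv_mul Q hdet
    ext i j
    have h2 := congrFun (congrFun h1 (Sum.inl i)) (Sum.inl j)
    rw [hL, hQp]
    simpa [Matrix.mul_apply, Matrix.one_apply] using h2
  have hinj : Function.Injective Qp.mulVec := by
    intro x y hxy
    have := congrArg L.mulVec hxy
    simpa [Matrix.mulVec_mulVec, hLQ] using this
  have hRQ : ((Qpᴴ * Qp)⁻¹ * Qpᴴ) * Qp = 1 := by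
    rw [Matrix.mul_assoc]
    exact Matrix.nonsing_inv_mul _ ((Matrix.isUnit_iff_isUnit_det _).mp (isUnit_gram Qp hinj))
  set R := (Qpᴴ * Qp)⁻¹ * Qpᴴ with hR
  have key : ∀ k Y, euclNorm (Qp.mulVec ((J ^ k).mulVec (R.mulVec Y))) ≤ δ⁻¹ * euclNorm Y := by
    intro k Y
    by_cases h0 : euclNorm Y = 0
    · rw [euclNorm_eq_zero h0]
      simp [euclNorm]
    have hpos : 0 < euclNorm Y := lt_of_le_of_ne (euclNorm_nonneg Y) (Ne.symm h0)
    have ha : ‖((δ / euclNorm Y : ℝ) : ℂ)‖ = δ / euclNorm Y := by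
      rw [Complex.norm_real, Real.norm_of_nonneg (by positivity)]
    have h1 := hs (((δ / euclNorm Y : ℝ) : ℂ) • Y)
      (by rw [euclNorm_smul, ha, div_mul_cancel₀ _ h0]) k
    rw [Matrix.mulVec_smul, Matrix.mulVec_smul, Matrix.mulVec_smul, euclNorm_smul, ha,
      div_mul_eq_mul_div, div_le_one hpos] at h1
    rw [inv_mul_eq_div, le_div_iff₀ hδ, mul_comm]
    exact h1
  have hb := matOpNorm_nonneg L
  have hc := matOpNorm_nonneg Qp
  refine ⟨matOpNorm L * (δ⁻¹ * matOpNorm Qp) + 1, by positivity, fun k => ?_⟩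
  refine le_trans (matOpNorm_le _ (matOpNorm L * (δ⁻¹ * matOpNorm Qp)) (by positivity)
    fun x => ?_) (by linarith)
  have e : (J ^ k).mulVec x
      = L.mulVec (Qp.mulVec ((J ^ k).mulVec (R.mulVec (Qp.mulVec x)))) := by
    rw [Matrix.mulVec_mulVec x R Qp, hRQ, Matrix.one_mulVec, Matrix.mulVec_mulVec _ L Qp, hLQ,
      Matrix.one_mulVec]
  rw [e]
  calc _ ≤ matOpNorm L * _ := euclNorm_mulVec_le _ _
    _ ≤ matOpNorm L * (δ⁻¹ * (matOpNorm Qp * euclNorm x)) := by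
      gcongr
      refine (key k _).trans ?_
      gcongr
      exact euclNorm_mulVec_le _ _
    _ = _ := by ring
end
end
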